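/- Fix ω₀ ∈ ℝ³ and let r_1, …, r_N, x_1, …, x_N : ℝ → ℝ³ be C¹ functions with ‖x_k(t)‖ = 1 for all t and all k, satisfying ṙ_k = x_k and ẋ_k = u_k^a × x_k with the control u_k^a = ω₀ + [(r_k − r_av) × ω₀ − x_av] × x_k, where r_av = (1/N) ∑_j r_j and x_av = (1/N) ∑_j x_j. Define v_k = x_k + r_k × ω₀ and v_av = (1/N) ∑_j v_j. Then for every k, v̇_k = −(v_k − v_av) + ⟨v_k − v_av, x_k⟩ x_k, and consequently the function S(t) = (1/2) ∑_{k=1}^N ‖v_k(t) − v_av(t)‖² satisfies S'(t) = − ∑_{k=1}^N ‖(v_k(t) − v_av(t)) × x_k(t)‖² ≤ 0. -/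

import Mathlib

noncomputable section

/-- Euclidean norm on `ℝ³` (represented as `Fin 3 → ℝ`). -/
def norm3 (v : Fin 3 → ℝ) : ℝ := Real.sqrt (∑ i, v i ^ 2)

/-- Euclidean inner product on `ℝ³`. -/
def inner3 (u v : Fin 3 → ℝ) : ℝ := ∑ i, u i * v i

/-- The cross product on `ℝ³`. -/
def cross3 (u v : Fin 3 → ℝ) : Fin 3 → ℝ := crossProduct u v

theorem norm3_sq (u : Fin 3 → ℝ) : norm3 u ^ 2 = inner3 u u := by
  rw [norm3, Real.sq_sqrt (Finset.sum_nonneg fun i _ => sq_nonneg (u i))]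
  simp only [inner3, sq]

theorem inner3_self_eq_one {u : Fin 3 → ℝ} (hu : norm3 u = 1) : inner3 u u = 1 := by
  rw [← norm3_sq, hu, one_pow]

/-- The vector triple product identity. -/
theorem cross3_cross3_self (a u : Fin 3 → ℝ) :
    cross3 (cross3 a u) u = inner3 a u • u - inner3 u u • a := by
  ext i
  fin_cases i <;> simp [cross3, cross_apply, inner3, Fin.sum_univ_three] <;> ring

/-- Lagrange's identity. -/
theorem norm3_cross3_sq (u w : Fin 3 → ℝ) :
    norm3 (cross3 u w) ^ 2 = inner3 u u * inner3 w w - inner3 u w ^ 2 := by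
  rw [norm3_sq]
  simp only [inner3, cross3, cross_apply, Fin.sum_univ_three, Matrix.cons_val]
  ring

theorem cross3_swap_add (u w : Fin 3 → ℝ) : cross3 u w + cross3 w u = 0 := by
  rw [cross3, cross3, ← cross_anticomm, neg_add_cancel]

/-- With `a = w - u` and `u` a unit vector, `(ω + a × u) × u + u × ω` is minus the projection
of `w` onto the orthogonal complement of `u`. -/
theorem cross3_control_add {u : Fin 3 → ℝ} (hu : inner3 u u = 1) (ω w : Fin 3 → ℝ) :
    cross3 (ω + cross3 (w - u) u) u + cross3 u ω = -w + inner3 w u • u := by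
  have hadd : cross3 (ω + cross3 (w - u) u) u = cross3 ω u + cross3 (cross3 (w - u) u) u := by
    simp [cross3]
  have hsub : inner3 (w - u) u = inner3 w u - 1 := by
    rw [← hu]
    simp only [inner3, Pi.sub_apply, sub_mul, Finset.sum_sub_distrib]
  rw [hadd, cross3_cross3_self, hu, hsub, add_right_comm, cross3_swap_add]
  module

theorem HasDerivAt.cross3_const {f : ℝ → Fin 3 → ℝ} {f' : Fin 3 → ℝ} {t : ℝ}
    (hf : HasDerivAt f f' t) (c : Fin 3 → ℝ) :
    HasDerivAt (fun s => cross3 (f s) c) (cross3 f' c) t :=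
  (LinearMap.toContinuousLinearMap (crossProduct.flip c)).hasFDerivAt.comp_hasDerivAt t hf

theorem HasDerivAt.norm3_sq {f : ℝ → Fin 3 → ℝ} {f' : Fin 3 → ℝ} {t : ℝ}
    (hf : HasDerivAt f f' t) :
    HasDerivAt (fun s => norm3 (f s) ^ 2) (2 * inner3 (f t) f') t := by
  simp only [_root_.norm3_sq, inner3]
  rw [hasDerivAt_pi] at hf
  refine (HasDerivAt.fun_sum fun i _ => (hf i).mul (hf i)).congr_deriv ?_
  rw [Finset.mul_sum]
  exact Finset.sum_congr rfl fun i _ => by ring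

/-- Deviations from the mean sum to zero. -/
theorem sum_sub_inv_smul_sum {N : ℕ} (hN : N ≠ 0) {E : Type*} [AddCommGroup E] [Module ℝ E]
    (w : Fin N → E) : ∑ k, (w k - (N : ℝ)⁻¹ • ∑ j, w j) = 0 := by
  rw [Finset.sum_sub_distrib, Finset.sum_const, Finset.card_univ, Fintype.card_fin,
    ← Nat.cast_smul_eq_nsmul ℝ, smul_inv_smul₀ (Nat.cast_ne_zero.mpr hN), sub_self]

theorem sum_inner3_sub {ι : Type*} [Fintype ι] {w : ι → Fin 3 → ℝ} (hw : ∑ k, w k = 0)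
    (d : ι → Fin 3 → ℝ) (c : Fin 3 → ℝ) :
    ∑ k, inner3 (w k) (d k - c) = ∑ k, inner3 (w k) (d k) := by
  have hc : ∑ k, inner3 (w k) c = 0 := by
    simp only [inner3]
    rw [Finset.sum_comm]
    refine Finset.sum_eq_zero fun i _ => ?_
    rw [← Finset.sum_mul, ← Finset.sum_apply, hw, Pi.zero_apply, zero_mul]
  simp only [inner3, Pi.sub_apply, mul_sub, Finset.sum_sub_distrib] at hc ⊢
  rw [hc, sub_zero]

theorem inner3_neg_add_smul {u : Fin 3 → ℝ} (hu : inner3 u u = 1) (w : Fin 3 → ℝ) :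
    inner3 w (-w + inner3 w u • u) = -norm3 (cross3 w u) ^ 2 := by
  rw [norm3_cross3_sq, hu]
  simp only [inner3, Fin.sum_univ_three, Pi.add_apply, Pi.neg_apply, Pi.smul_apply, smul_eq_mul]
  ring

/-- For the screw-formation control
`u_k^a = ω₀ + [(r_k − r_av) × ω₀ − x_av] × x_k`, the spatial twist components
`v_k = x_k + r_k × ω₀` satisfy `v̇_k = −(v_k − v_av) + ⟨v_k − v_av, x_k⟩ x_k`, and the
Lyapunov function `S = (1/2) ∑_k ‖v_k − v_av‖²` satisfies
`S' = − ∑_k ‖(v_k − v_av) × x_k‖² ≤ 0`. -/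
theorem screw_formation_lyapunov
    (N : ℕ) (hN : 1 ≤ N) (ω₀ : Fin 3 → ℝ)
    (r x : Fin N → ℝ → Fin 3 → ℝ)
    (rav xav : ℝ → Fin 3 → ℝ)
    (hrav : ∀ t, rav t = (N : ℝ)⁻¹ • ∑ j, r j t)
    (hxav : ∀ t, xav t = (N : ℝ)⁻¹ • ∑ j, x j t)
    (hunit : ∀ k t, norm3 (x k t) = 1)
    (hr : ∀ k t, HasDerivAt (r k) (x k t) t)
    (hx : ∀ k t, HasDerivAt (x k)
      (cross3 (ω₀ + cross3 (cross3 (r k t - rav t) ω₀ - xav t) (x k t)) (x k t)) t)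
    (v : Fin N → ℝ → Fin 3 → ℝ)
    (hv : ∀ k t, v k t = x k t + cross3 (r k t) ω₀)
    (vav : ℝ → Fin 3 → ℝ)
    (hvav : ∀ t, vav t = (N : ℝ)⁻¹ • ∑ j, v j t) :
    (∀ k t, HasDerivAt (v k)
      (-(v k t - vav t) + inner3 (v k t - vav t) (x k t) • x k t) t) ∧
    (∀ t,
      HasDerivAt (fun s => (1 / 2 : ℝ) * ∑ k, norm3 (v k s - vav s) ^ 2)
        (-(∑ k, norm3 (cross3 (v k t - vav t) (x k t)) ^ 2)) t ∧
      -(∑ k, norm3 (cross3 (v k t - vav t) (x k t)) ^ 2) ≤ 0) := by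
  have hu k t : inner3 (x k t) (x k t) = 1 := inner3_self_eq_one (hunit k t)
  have hmean t : vav t = xav t + cross3 (rav t) ω₀ := by
    simp only [hvav, hxav, hrav, hv, Finset.sum_add_distrib, smul_add]
    simp [cross3, map_sum, LinearMap.sum_apply]
  have hderiv k t : HasDerivAt (v k)
      (-(v k t - vav t) + inner3 (v k t - vav t) (x k t) • x k t) t := by
    have hctrl : cross3 (r k t - rav t) ω₀ - xav t = (v k t - vav t) - x k t := by
      rw [hv, hmean]
      simp only [cross3, map_sub, LinearMap.sub_apply]
      abel
    rw [← cross3_control_add (hu k t) ω₀, ← hctrl, funext (hv k)]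
    exact (hx k t).add ((hr k t).cross3_const ω₀)
  refine ⟨hderiv, fun t => ⟨?_, neg_nonpos.mpr (Finset.sum_nonneg fun k _ => sq_nonneg _)⟩⟩
  have hsum : ∑ k, (v k t - vav t) = 0 := by
    rw [hvav]
    exact sum_sub_inv_smul_sum (Nat.one_le_iff_ne_zero.mp hN) fun k => v k t
  have hav := (HasDerivAt.fun_sum (u := Finset.univ) fun k _ => hderiv k t).const_smul (N : ℝ)⁻¹
  have hav' := hav.congr_of_eventuallyEq (Filter.Eventually.of_forall hvav)
  refine ((HasDerivAt.fun_sum fun k _ => ((hderiv k t).sub hav').norm3_sq).const_mul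
    (1 / 2 : ℝ)).congr_deriv ?_
  simp only [Pi.sub_apply]
  rw [← Finset.mul_sum, sum_inner3_sub hsum, ← mul_assoc, ← Finset.sum_neg_distrib]
  norm_num only [one_mul]
  exact Finset.sum_congr rfl fun k _ => inner3_neg_add_smul (hu k t) _
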